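/- arXiv:2005.11095 — 9 statements merged into one kernel-verified Lean document; each statement's English description precedes it below -/
import Mathlib

section
/- There exists an infinite subset 𝒮 of ℤ_{≤ −1} (the negative integers) such that (𝒮, 𝒯) is a co-minimal pair in (ℤ, +), where 𝒯 = {2^n : n ≥ 0} = {1, 2, 4, 8, ...}. -/
open scoped Pointwise

/-- Nonempty subsets `A`, `B` of an abelian group `G` form a *co-minimal pair* if
`A + B = G`, no nonempty proper subset of `A` is an additive complement of `B`,
and no nonempty proper subset of `B` is an additive complement of `A`. -/
def IsCoMinimalPair {G : Type*} [AddCommGroup G] (A B : Set G) : Prop :=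
  A.Nonempty ∧ B.Nonempty ∧ A + B = Set.univ ∧
    (∀ A' : Set G, A'.Nonempty → A' ⊂ A → A' + B ≠ Set.univ) ∧
    (∀ B' : Set G, B'.Nonempty → B' ⊂ B → A + B' ≠ Set.univ)

/-- `𝒯 = {1, 2, 4, 8, ...}`, the powers of two. -/
def Tset : Set ℤ := {x | ∃ n : ℕ, x = 2 ^ n}

/-- `J_0 = J_1 = {1}`, `J_n = {1, ..., 2^(n-2)} ∪ (2^(n-1) + J_(n-1))` for `n ≥ 2`. -/
def Jset : ℕ → Set ℤ
  | 0 => {1}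
  | 1 => {1}
  | n + 2 => Set.Icc (1 : ℤ) (2 ^ n) ∪ (fun x => 2 ^ (n + 1) + x) '' Jset (n + 1)

/-- `K_0 = J_0`, `K_1 = J_1`, `K_2 = J_2 \ {1}`, and
`K_n = {2^(n-3)+1, ..., 2^(n-2)} ∪ (2^(n-1) + 2^(n-2) + J_(n-2))` for `n ≥ 3`. -/
def Kset : ℕ → Set ℤ
  | 0 => Jset 0
  | 1 => Jset 1
  | 2 => Jset 2 \ {1}
  | n + 3 => Set.Icc ((2 : ℤ) ^ n + 1) (2 ^ (n + 1)) ∪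
      (fun x => 2 ^ (n + 2) + 2 ^ (n + 1) + x) '' Jset (n + 1)

/-- `I_n = K_n − (1 + 2^(n+1))`. -/
def Iset (n : ℕ) : Set ℤ := (fun x => x - (1 + 2 ^ (n + 1))) '' Kset n

/-- `S = ⋃_{n ≥ 0} I_n`. -/
def Sset : Set ℤ := ⋃ n, Iset n

/-- A finite set of pairs `(s, n)` with `s` negative such that `s + 2 ^ n` cannot be written as
`s' + 2 ^ m` with another first component `s'`. -/
def UniquelyWitnessed (P : Finset (ℤ × ℕ)) : Prop :=
  (∀ p ∈ P, p.1 < 0) ∧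
    ∀ p ∈ P, ∀ q ∈ P, ∀ m : ℕ, q.1 + 2 ^ m = p.1 + 2 ^ p.2 → q.1 = p.1

theorem UniquelyWitnessed.insert_pair {P : Finset (ℤ × ℕ)} (hP : UniquelyWitnessed P) {x : ℤ} {k : ℕ}
    (hx : x < 0) (h₁ : ∀ p ∈ P, ∀ m : ℕ, x + 2 ^ m ≠ p.1 + 2 ^ p.2)
    (h₂ : ∀ q ∈ P, ∀ m : ℕ, q.1 + 2 ^ m ≠ x + 2 ^ k) :
    UniquelyWitnessed (insert (x, k) P) := by
  refine ⟨fun p hp => ?_, fun p hp q hq m h => ?_⟩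
  · rcases Finset.mem_insert.1 hp with rfl | hp
    exacts [hx, hP.1 p hp]
  · rcases Finset.mem_insert.1 hp with rfl | hp <;> rcases Finset.mem_insert.1 hq with rfl | hq
    · rfl
    · exact absurd h (h₂ q hq m)
    · exact absurd h (h₁ p hp m)
    · exact hP.2 p hp q hq m h

theorem eventually_lt_two_pow (c : ℤ) : ∀ᶠ n : ℕ in Filter.atTop, c < 2 ^ n :=
  (tendsto_pow_atTop_atTop_of_one_lt (by norm_num : (1 : ℤ) < 2)).eventually_gt_atTop c

theorem eventually_sub_two_pow_ne {z w : ℤ} (h : z ≠ w) :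
    ∀ᶠ n : ℕ in Filter.atTop, ∀ m : ℕ, z - 2 ^ n + 2 ^ m ≠ w := by
  filter_upwards [eventually_lt_two_pow (2 * |z - w|)] with n hn m hm
  have hz := le_abs_self (z - w)
  have hz' := neg_abs_le (z - w)
  rcases lt_trichotomy m n with hmn | rfl | hmn
  · have : (2 : ℤ) ^ (m + 1) ≤ 2 ^ n := pow_le_pow_right₀ (by norm_num) hmn
    rw [pow_succ] at this
    linarith
  · exact h (by linarith)
  · have : (2 : ℤ) ^ (n + 1) ≤ 2 ^ m := pow_le_pow_right₀ (by norm_num) hmn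
    rw [pow_succ] at this
    linarith [abs_nonneg (z - w)]

theorem UniquelyWitnessed.exists_superset_represents {P : Finset (ℤ × ℕ)}
    (hP : UniquelyWitnessed P) (z : ℤ) :
    ∃ Q, UniquelyWitnessed Q ∧ P ⊆ Q ∧ ∃ q ∈ Q, ∃ m : ℕ, q.1 + 2 ^ m = z := by
  by_cases hz : ∃ q ∈ P, ∃ m : ℕ, q.1 + 2 ^ m = z
  · exact ⟨P, hP, subset_rfl, hz⟩
  push Not at hz
  obtain ⟨n, hn, hn'⟩ := ((eventually_lt_two_pow z).and ((Finset.eventually_all P).2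
    fun p hp => eventually_sub_two_pow_ne (hz p hp p.2).symm)).exists
  exact ⟨insert (z - 2 ^ n, n) P,
    hP.insert_pair (by linarith) hn' (fun q hq m => by simpa using hz q hq m),
    Finset.subset_insert _ _, _, Finset.mem_insert_self _ _, n, by simp⟩

theorem UniquelyWitnessed.exists_superset_mem {P : Finset (ℤ × ℕ)}
    (hP : UniquelyWitnessed P) (k : ℕ) :
    ∃ Q, UniquelyWitnessed Q ∧ P ⊆ Q ∧ ∃ x, (x, k) ∈ Q := by
  obtain ⟨z, hz⟩ := Infinite.exists_notMem_finset (P.image fun p => p.1 + 2 ^ p.2)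
  have hz' : ∀ p ∈ P, z ≠ p.1 + 2 ^ p.2 := fun p hp h =>
    hz (Finset.mem_image.2 ⟨p, hp, h.symm⟩)
  obtain ⟨n, hn, hn₁, hn₂⟩ := ((eventually_lt_two_pow z).and (((Finset.eventually_all P).2
    fun p hp => eventually_sub_two_pow_ne (hz' p hp)).and ((Finset.eventually_all P).2
    fun p _ => eventually_lt_two_pow (z + 2 ^ k - p.1)))).exists
  refine ⟨insert (z - 2 ^ n, k) P, hP.insert_pair (by linarith) hn₁ (fun q hq m h => ?_),
    Finset.subset_insert _ _, _, Finset.mem_insert_self _ _⟩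
  have := hn₂ q hq
  have : (0 : ℤ) < 2 ^ m := by positivity
  linarith

/-- A set of negative integers complementing `Tset`, together with uniquely represented witnesses
for all of its elements and for all powers of two. -/
theorem exists_negative_complement_with_witnesses :
    ∃ R : Set (ℤ × ℕ), (∀ p ∈ R, p.1 < 0) ∧
      (∀ p ∈ R, ∀ q ∈ R, ∀ m : ℕ, q.1 + 2 ^ m = p.1 + 2 ^ p.2 → q.1 = p.1) ∧
      (∀ z : ℤ, ∃ q ∈ R, ∃ m : ℕ, q.1 + 2 ^ m = z) ∧ ∀ k : ℕ, ∃ x, (x, k) ∈ R := by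
  let 𝒟 : ℤ ⊕ ℕ → Order.Cofinal {P : Finset (ℤ × ℕ) // UniquelyWitnessed P} := Sum.elim
    (fun z => ⟨{Q | ∃ q ∈ Q.1, ∃ m : ℕ, q.1 + 2 ^ m = z}, fun P =>
      let ⟨Q, hQ, hPQ, h⟩ := P.2.exists_superset_represents z
      ⟨⟨Q, hQ⟩, h, hPQ⟩⟩)
    (fun k => ⟨{Q | ∃ x, (x, k) ∈ Q.1}, fun P =>
      let ⟨Q, hQ, hPQ, h⟩ := P.2.exists_superset_mem k
      ⟨⟨Q, hQ⟩, h, hPQ⟩⟩)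
  let I := Order.idealOfCofinals
    (⟨∅, by simp [UniquelyWitnessed]⟩ : {P : Finset (ℤ × ℕ) // UniquelyWitnessed P}) 𝒟
  refine ⟨{p | ∃ P ∈ I, p ∈ P.1}, ?_, ?_, fun z => ?_, fun k => ?_⟩
  · rintro p ⟨P, -, hp⟩
    exact P.2.1 p hp
  · rintro p ⟨P, hPI, hp⟩ q ⟨Q, hQI, hq⟩
    obtain ⟨U, -, hPU, hQU⟩ := I.directed P hPI Q hQI
    exact U.2.2 p (hPU hp) q (hQU hq)
  · obtain ⟨P, ⟨q, hq, m, hm⟩, hPI⟩ := Order.cofinal_meets_idealOfCofinals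
      (⟨∅, by simp [UniquelyWitnessed]⟩ : {P : Finset (ℤ × ℕ) // UniquelyWitnessed P}) 𝒟 (.inl z)
    exact ⟨q, ⟨P, hPI, hq⟩, m, hm⟩
  · obtain ⟨P, ⟨x, hx⟩, hPI⟩ := Order.cofinal_meets_idealOfCofinals
      (⟨∅, by simp [UniquelyWitnessed]⟩ : {P : Finset (ℤ × ℕ) // UniquelyWitnessed P}) 𝒟 (.inr k)
    exact ⟨x, P, hPI, hx⟩

/-- There exists an infinite subset `𝒮` of the negative integers such that
`(𝒮, 𝒯)` is a co-minimal pair in `ℤ`. -/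
theorem exists_infinite_cominimal_with_Tset :
    ∃ 𝒮 : Set ℤ, 𝒮.Infinite ∧ (∀ s ∈ 𝒮, s ≤ -1) ∧ IsCoMinimalPair 𝒮 Tset := by
  obtain ⟨R, hneg, huniq, hrep, hpow⟩ := exists_negative_complement_with_witnesses
  have hsum : Prod.fst '' R + Tset = Set.univ := by
    refine Set.eq_univ_of_forall fun z => ?_
    obtain ⟨q, hq, m, rfl⟩ := hrep z
    exact Set.add_mem_add ⟨q, hq, rfl⟩ ⟨m, rfl⟩
  refine ⟨Prod.fst '' R, fun hfin => ?_, ?_, ?_, ⟨1, 0, rfl⟩, hsum, ?_, ?_⟩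
  · obtain ⟨b, hb⟩ := hfin.bddBelow
    obtain ⟨q, hq, m, hm⟩ := hrep b
    have := hb ⟨q, hq, rfl⟩
    have : (0 : ℤ) < 2 ^ m := by positivity
    linarith
  · rintro _ ⟨p, hp, rfl⟩
    have := hneg p hp
    lia
  · obtain ⟨x, hx⟩ := hpow 0
    exact ⟨x, _, hx, rfl⟩
  · intro A' _ hA' h
    obtain ⟨_, ⟨p, hp, rfl⟩, hpA⟩ := Set.exists_of_ssubset hA'
    obtain ⟨a, ha, _, ⟨m, rfl⟩, ham⟩ := Set.mem_add.1 (h ▸ Set.mem_univ (p.1 + 2 ^ p.2))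
    obtain ⟨q, hq, rfl⟩ := hA'.1 ha
    exact hpA (huniq p hp q hq m ham ▸ ha)
  · intro B' _ hB' h
    obtain ⟨_, ⟨k, rfl⟩, hkB⟩ := Set.exists_of_ssubset hB'
    obtain ⟨x, hx⟩ := hpow k
    obtain ⟨_, ⟨q, hq, rfl⟩, b, hb, hqb⟩ := Set.mem_add.1 (h ▸ Set.mem_univ (x + 2 ^ k))
    obtain ⟨m, rfl⟩ := hB'.1 hb
    have hqx : q.1 = x := huniq _ hx q hq m hqb
    rw [hqx, add_right_inj] at hqb
    exact hkB (hqb ▸ hb)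
end

section
/- S + 𝒯 = ℤ, i.e., 𝒯 is an additive complement of S in ℤ: every integer can be written as s + t with s ∈ S and t ∈ 𝒯. -/
open scoped Pointwise

/-- The positive integers that equal `1` or whose binary expansion starts with `11`. -/
def LeadingOnes (y : ℤ) : Prop := y = 1 ∨ ∃ b : ℕ, 3 * 2 ^ b ≤ y ∧ y < 4 * 2 ^ b

lemma LeadingOnes.pos {y : ℤ} (hy : LeadingOnes y) : 0 < y := by
  rcases hy with rfl | ⟨b, hb, -⟩
  · norm_num
  · have : (0 : ℤ) < 2 ^ b := by positivity
    lia

/-- A nonnegative integer is zero, has `1` or `11` as leading binary digits, or `10`. -/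
lemma eq_zero_or_leadingOnes_or (x : ℤ) (hx : 0 ≤ x) :
    x = 0 ∨ LeadingOnes x ∨ ∃ (b : ℕ) (z : ℤ), 0 ≤ z ∧ z < 2 ^ b ∧ x = 2 ^ (b + 1) + z := by
  rcases hx.eq_or_lt with h0 | hpos
  · exact Or.inl h0.symm
  right
  lift x to ℕ using hx
  have hx0 : x ≠ 0 := by lia
  have hlo := Nat.pow_log_le_self 2 hx0
  have hhi := Nat.lt_pow_succ_log_self (b := 2) (by norm_num) x
  generalize Nat.log 2 x = n at hlo hhi
  zify at hlo hhi
  rcases n with _ | b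
  · left; left
    norm_num at hlo hhi
    lia
  · rcases lt_or_ge (x : ℤ) (3 * 2 ^ b) with h | h
    · right
      refine ⟨b, x - 2 ^ (b + 1), by lia, ?_, by ring⟩
      rw [pow_succ]
      lia
    · left; right
      refine ⟨b, h, ?_⟩
      rw [pow_succ, pow_succ] at hhi
      lia

lemma two_pow_sub_mem_Jset (n : ℕ) {y : ℤ} (hy : LeadingOnes y) (hlt : y < 2 ^ (n + 1)) :
    2 ^ (n + 1) - y ∈ Jset (n + 1) := by
  induction n with
  | zero =>
    have := hy.pos
    norm_num at hlt
    obtain rfl : y = 1 := by lia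
    simp [Jset]
  | succ n ih =>
    rw [Jset]
    rcases lt_or_ge y (2 ^ (n + 1)) with h | h
    · exact Or.inr ⟨_, ih h, by ring⟩
    · left
      have h2 : (2 : ℤ) ^ (n + 1) = 2 * 2 ^ n := by ring
      have h4 : (2 : ℤ) ^ (n + 1 + 1) = 4 * 2 ^ n := by ring
      have hn : (0 : ℤ) < 2 ^ n := by positivity
      refine ⟨by lia, ?_⟩
      rcases hy with rfl | ⟨b, hb, hb'⟩
      · lia
      · have hnb : n ≤ b := by
          by_contra! hc
          have : (2 : ℤ) ^ (b + 1) ≤ 2 ^ n := pow_le_pow_right₀ (by norm_num) hc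
          rw [pow_succ] at this
          lia
        have : (2 : ℤ) ^ n ≤ 2 ^ b := pow_le_pow_right₀ (by norm_num) hnb
        lia

lemma sub_mem_Sset {n : ℕ} {k x : ℤ} (hk : k ∈ Kset n) (hx : k - (1 + 2 ^ (n + 1)) = x) :
    x ∈ Sset :=
  Set.mem_iUnion.2 ⟨n, k, hk, hx⟩

lemma neg_mem_Sset_of_prefix_1110 (c : ℕ) {x : ℤ} (hlo : 14 * 2 ^ c ≤ x) (hhi : x < 15 * 2 ^ c) :
    -(x + 1) ∈ Sset := by
  refine sub_mem_Sset (n := c + 3) (k := 2 ^ (c + 3 + 1) - x) (Or.inl ⟨?_, ?_⟩) (by ring) <;>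
    simp only [pow_succ] <;> lia

lemma neg_mem_Sset_of_leadingOnes (n : ℕ) {y : ℤ} (hy : LeadingOnes y) (hlt : y < 2 ^ (n + 1)) :
    -(2 ^ (n + 3) + y + 1) ∈ Sset :=
  sub_mem_Sset (n := n + 3) (Or.inr ⟨_, two_pow_sub_mem_Jset n hy hlt, rfl⟩) (by ring)

lemma neg_two_pow_add_two_mem_Sset (n : ℕ) : -((2 : ℤ) ^ (n + 1) + 2) ∈ Sset := by
  match n with
  | 0 => exact sub_mem_Sset (n := 1) (k := 1) (by simp [Kset, Jset]) (by norm_num)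
  | 1 => exact sub_mem_Sset (n := 2) (k := 3) (by simp [Kset, Jset]) (by norm_num)
  | n + 2 =>
    have h := neg_mem_Sset_of_leadingOnes n (Or.inl rfl) (one_lt_pow₀ (by norm_num) (by simp))
    convert h using 1
    ring

lemma neg_two_mem_Sset : (-2 : ℤ) ∈ Sset :=
  sub_mem_Sset (n := 0) (k := 1) (by simp [Kset, Jset]) (by norm_num)

lemma exists_sub_two_pow_mem_of_nonneg (m : ℤ) (hm : 0 ≤ m) : ∃ t : ℕ, m - 2 ^ t ∈ Sset := by
  rcases hm.eq_or_lt with rfl | hpos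
  · exact ⟨1, by simpa using neg_two_mem_Sset⟩
  lift m to ℕ using hm
  have hlo := Nat.pow_log_le_self 2 (x := m) (by lia)
  have hhi := Nat.lt_pow_succ_log_self (b := 2) (by norm_num) m
  generalize Nat.log 2 m = k at hlo hhi
  zify at hlo hhi
  refine ⟨k + 4, ?_⟩
  have h := neg_mem_Sset_of_prefix_1110 k (x := 2 ^ (k + 4) - m - 1)
    (by simp only [pow_succ] at *; lia) (by simp only [pow_succ] at *; lia)
  convert h using 1
  ring

lemma exists_neg_add_two_pow_mem (N : ℤ) (hN : 0 ≤ N) :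
    ∃ t : ℕ, -(N + 2 ^ t + 1) ∈ Sset := by
  rcases eq_zero_or_leadingOnes_or N hN with rfl | h | ⟨n, y, hy0, hyn, rfl⟩
  · exact ⟨0, by simpa using neg_two_mem_Sset⟩
  · obtain ⟨k, hk⟩ := pow_unbounded_of_one_lt N (by norm_num : (1 : ℤ) < 2)
    refine ⟨k + 3, ?_⟩
    rw [add_comm N]
    exact neg_mem_Sset_of_leadingOnes k h (by rw [pow_succ]; lia)
  rcases eq_zero_or_leadingOnes_or y hy0 with rfl | h | ⟨b, z, hz0, hzb, rfl⟩
  · refine ⟨0, ?_⟩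
    convert neg_two_pow_add_two_mem_Sset n using 1
    ring
  · obtain _ | n := n
    · have := h.pos
      norm_num at hyn
      lia
    refine ⟨n + 2, ?_⟩
    convert neg_mem_Sset_of_leadingOnes n h hyn using 1
    ring
  · have hbn : b + 1 < n :=
      (pow_lt_pow_iff_right₀ (by norm_num : (1 : ℤ) < 2)).1 (by lia)
    obtain ⟨n, rfl⟩ := Nat.exists_eq_add_of_lt hbn
    obtain _ | n := n
    · refine ⟨b + 2, ?_⟩
      convert neg_mem_Sset_of_prefix_1110 b (x := 14 * 2 ^ b + z) (by lia) (by lia) using 1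
      ring
    · have hle : (2 : ℤ) ^ (b + 2) ≤ 2 ^ (b + n + 2) := pow_le_pow_right₀ (by norm_num) (by lia)
      refine ⟨b, ?_⟩
      have h : LeadingOnes (3 * 2 ^ b + z) := Or.inr ⟨b, by lia, by lia⟩
      convert neg_mem_Sset_of_leadingOnes (b + n + 1) h (by rw [pow_add _ b 2] at hle; lia) using 1
      ring

/-- `𝒯` is an additive complement of `S` in `ℤ`: `S + 𝒯 = ℤ`. -/
theorem Sset_add_Tset_eq_univ : Sset + Tset = Set.univ := by
  refine Set.eq_univ_of_forall fun m => ?_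
  suffices ∃ t : ℕ, m - 2 ^ t ∈ Sset by
    obtain ⟨t, ht⟩ := this
    exact Set.mem_add.2 ⟨_, ht, 2 ^ t, ⟨t, rfl⟩, by ring⟩
  rcases le_or_gt 0 m with hm | hm
  · exact exists_sub_two_pow_mem_of_nonneg m hm
  · obtain ⟨t, ht⟩ := exists_neg_add_two_pow_mem (-m - 1) (by lia)
    refine ⟨t, ?_⟩
    convert ht using 1
    ring
end

section
/- If 𝒮 ⊆ S and 𝒯' ⊆ 𝒯 are nonempty subsets with 𝒮 + 𝒯' = ℤ, then 𝒯' = 𝒯; more precisely, 𝒯' contains 1, 2, and 2^{n−1} for every n ≥ 3. -/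
open scoped Pointwise

/-- Two powers of two differ by a factor of at least two, also after scaling by `2 ^ c`. -/
theorem pow_two_dichotomy (c a b : ℕ) :
    (2 : ℤ) ^ c * 2 ^ a ≤ 2 ^ b ∨ 2 * (2 : ℤ) ^ b ≤ 2 ^ c * 2 ^ a := by
  rcases le_or_gt (c + a) b with h | h
  · left
    rw [← pow_add]
    exact pow_le_pow_right₀ (by norm_num) h
  · right
    rw [← pow_add, ← pow_succ']
    exact pow_le_pow_right₀ (by norm_num) h

/-- The distance from an element of `J_n` to `2 ^ n` has binary expansion `1` or `11…`. -/
theorem two_pow_sub_of_mem_Jset {n : ℕ} {x : ℤ} (hx : x ∈ Jset (n + 1)) :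
    2 ^ (n + 1) - x = 1 ∨
      ∃ i : ℕ, i + 1 ≤ n ∧ 3 * 2 ^ i ≤ 2 ^ (n + 1) - x ∧ 2 ^ (n + 1) - x < 4 * 2 ^ i := by
  induction n generalizing x with
  | zero =>
    left
    simp only [Jset, Set.mem_singleton_iff] at hx
    simp [hx]
  | succ n ih =>
    simp only [Jset] at hx
    rcases hx with ⟨h1, h2⟩ | ⟨y, hy, rfl⟩
    · right
      refine ⟨n, le_rfl, ?_, ?_⟩ <;> rw [pow_succ, pow_succ] <;> linarith
    · have e : (2 : ℤ) ^ (n + 1 + 1) - (2 ^ (n + 1) + y) = 2 ^ (n + 1) - y := by ring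
      simp only [e]
      rcases ih hy with h | ⟨i, hi, h⟩
      · exact Or.inl h
      · exact Or.inr ⟨i, by omega, h⟩

/-- The shape of the negative of an element of `S`. -/
theorem neg_of_mem_Sset {s : ℤ} (hs : s ∈ Sset) :
    (-s = 2 ∨ -s = 4 ∨ -s = 6) ∨ (∃ i : ℕ, 14 * 2 ^ i < -s ∧ -s ≤ 15 * 2 ^ i) ∨
      ∃ (p : ℕ) (t : ℤ), 1 ≤ p ∧ -s = 4 * 2 ^ p + t ∧
        (t = 2 ∨ ∃ i : ℕ, i + 2 ≤ p ∧ 3 * 2 ^ i < t ∧ t ≤ 4 * 2 ^ i) := by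
  obtain ⟨n, x, hx, rfl⟩ := Set.mem_iUnion.1 hs
  match n, hx with
  | 0, hx =>
    simp only [Kset, Jset, Set.mem_singleton_iff] at hx
    simp [hx]
  | 1, hx =>
    simp only [Kset, Jset, Set.mem_singleton_iff] at hx
    simp [hx]
  | 2, hx =>
    simp only [Kset, Jset] at hx
    obtain ⟨⟨h1, h2⟩ | ⟨y, hy, rfl⟩, h⟩ := hx
    · exact absurd (le_antisymm (by simpa using h2) h1) h
    · rw [Set.mem_singleton_iff] at hy
      simp [hy]
  | n + 3, hx =>
    simp only [Kset] at hx
    right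
    have e : (2 : ℤ) ^ (n + 3 + 1) = 16 * 2 ^ n := by ring
    rcases hx with ⟨h1, h2⟩ | ⟨y, hy, rfl⟩
    · left
      rw [pow_succ] at h2
      refine ⟨n, ?_, ?_⟩ <;> simp only [e] <;> linarith
    · right
      refine ⟨n + 1, 2 ^ (n + 1) - y + 1, by omega, by ring, ?_⟩
      rcases two_pow_sub_of_mem_Jset hy with h | ⟨i, hi, h1, h2⟩
      · left
        rw [h]
        norm_num
      · exact Or.inr ⟨i, by omega, by linarith, by linarith⟩

/-- A version of `neg_of_mem_Sset` adapted to linear arithmetic. -/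
theorem neg_of_mem_Sset' {s : ℤ} (hs : s ∈ Sset) :
    (-s = 2 ∨ -s = 4 ∨ -s = 6) ∨ (∃ i : ℕ, 14 * 2 ^ i < -s ∧ -s ≤ 15 * 2 ^ i) ∨
      ∃ (p : ℕ) (t : ℤ), 2 ≤ (2 : ℤ) ^ p ∧ -s = 4 * 2 ^ p + t ∧ 2 ≤ t ∧ t ≤ 2 ^ p ∧
        (t = 2 ∨ ∃ i : ℕ, 3 * 2 ^ i < t ∧ t ≤ 4 * 2 ^ i) := by
  rcases neg_of_mem_Sset hs with h | h | ⟨p, t, hp, h, ht⟩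
  · exact Or.inl h
  · exact Or.inr (Or.inl h)
  · have hP : (2 : ℤ) ≤ 2 ^ p := le_self_pow₀ (by norm_num) (by omega)
    refine Or.inr (Or.inr ⟨p, t, hP, h, ?_⟩)
    rcases ht with rfl | ⟨i, hi, h1, h2⟩
    · exact ⟨le_rfl, hP, Or.inl rfl⟩
    · have hA : (0 : ℤ) < 2 ^ i := by positivity
      have hiP : (2 : ℤ) ^ (i + 2) ≤ 2 ^ p := pow_le_pow_right₀ (by norm_num) hi
      rw [pow_add] at hiP
      exact ⟨by linarith, by linarith, Or.inr ⟨i, h1, h2⟩⟩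

theorem eq_zero_of_add_two_pow_eq {s : ℤ} {k : ℕ} (hs : s ∈ Sset) (h : s + 2 ^ k = -1) :
    k = 0 := by
  by_contra hk
  have hK : (2 : ℤ) ^ k = 2 * 2 ^ (k - 1) := by rw [← pow_succ']; congr 1; omega
  have hK0 : (0 : ℤ) < 2 ^ (k - 1) := by positivity
  rcases neg_of_mem_Sset' hs with h' | ⟨i, h1, h2⟩ | ⟨p, t, hP, ht, ht2, htP, -⟩
  · have := pow_two_dichotomy 1 0 (k - 1)
    have := pow_two_dichotomy 2 0 (k - 1)
    omega
  · have := pow_two_dichotomy 4 i k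
    omega
  · have := pow_two_dichotomy 3 p k
    omega

theorem eq_one_of_add_two_pow_eq {s : ℤ} {k : ℕ} (hs : s ∈ Sset) (h : s + 2 ^ k = -37) :
    k = 1 := by
  have hk : k = 0 ∨ k = 1 ∨ k = 2 ∨ k = 3 ∨ k = 4 ∨ k = 5 ∨ (64 : ℤ) ≤ 2 ^ k := by
    rcases lt_or_ge k 6 with hk | hk
    · omega
    · have : (2 : ℤ) ^ 6 ≤ 2 ^ k := pow_le_pow_right₀ (by norm_num) hk
      omega
  by_contra hk1
  rcases neg_of_mem_Sset' hs with h' | ⟨i, h1, h2⟩ | ⟨p, t, hP, ht, ht2, htP, htt⟩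
  · have : (0 : ℤ) < 2 ^ k := by positivity
    omega
  · have := pow_two_dichotomy 4 i k
    have := pow_two_dichotomy 0 i 1
    have := pow_two_dichotomy 0 i 2
    rcases hk with rfl | rfl | rfl | rfl | rfl | rfl | hk <;> omega
  · have := pow_two_dichotomy 3 p k
    have := pow_two_dichotomy 2 p k
    have := pow_two_dichotomy 0 p 2
    have := pow_two_dichotomy 0 p 3
    rcases htt with rfl | ⟨i, h1, h2⟩
    · rcases hk with rfl | rfl | rfl | rfl | rfl | rfl | hk <;> omega
    · have := pow_two_dichotomy 0 i 0
      have := pow_two_dichotomy 0 i 1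
      have := pow_two_dichotomy 0 i 2
      have := pow_two_dichotomy 0 i 3
      rcases hk with rfl | rfl | rfl | rfl | rfl | rfl | hk <;> omega

theorem eq_two_of_add_two_pow_eq {s : ℤ} {k : ℕ} (hs : s ∈ Sset) (h : s + 2 ^ k = -6) :
    k = 2 := by
  have hk : k = 0 ∨ k = 1 ∨ k = 2 ∨ k = 3 ∨ (16 : ℤ) ≤ 2 ^ k := by
    rcases lt_or_ge k 4 with hk | hk
    · omega
    · have : (2 : ℤ) ^ 4 ≤ 2 ^ k := pow_le_pow_right₀ (by norm_num) hk
      omega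
  by_contra hk2
  rcases neg_of_mem_Sset' hs with h' | ⟨i, h1, h2⟩ | ⟨p, t, hP, ht, ht2, htP, htt⟩
  · have : (0 : ℤ) < 2 ^ k := by positivity
    omega
  · have := pow_two_dichotomy 4 i k
    have := pow_two_dichotomy 0 i 0
    rcases hk with rfl | rfl | rfl | rfl | hk <;> omega
  · have := pow_two_dichotomy 3 p k
    have := pow_two_dichotomy 2 p k
    have := pow_two_dichotomy 0 p 1
    rcases htt with rfl | ⟨i, h1, h2⟩
    · rcases hk with rfl | rfl | rfl | rfl | hk <;> omega
    · have := pow_two_dichotomy 0 i 0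
      rcases hk with rfl | rfl | rfl | rfl | hk <;> omega

theorem eq_add_two_of_add_two_pow_eq {s : ℤ} {k m : ℕ} (hm : 1 ≤ m) (hs : s ∈ Sset)
    (h : s + 2 ^ k = -(5 * 2 ^ m)) : k = m + 2 := by
  have hM : (2 : ℤ) ≤ 2 ^ m := le_self_pow₀ (by norm_num) (by omega)
  have hK : (0 : ℤ) < 2 ^ k := by positivity
  have hk : k = m + 2 ∨ (2 : ℤ) ^ k ≤ 2 * 2 ^ m ∨ 8 * (2 : ℤ) ^ m ≤ 2 ^ k := by
    rcases lt_trichotomy k (m + 2) with hk | hk | hk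
    · right; left
      rw [← pow_succ']
      exact pow_le_pow_right₀ (by norm_num) (by omega)
    · exact Or.inl hk
    · right; right
      have : (2 : ℤ) ^ (m + 3) ≤ 2 ^ k := pow_le_pow_right₀ (by norm_num) hk
      rw [pow_add] at this
      linarith
  refine hk.resolve_right fun hk => ?_
  rcases neg_of_mem_Sset' hs with h' | ⟨i, h1, h2⟩ | ⟨p, t, hP, ht, ht2, htP, htt⟩
  · omega
  · have := pow_two_dichotomy 2 i m
    have := pow_two_dichotomy 4 i k
    omega
  · have := pow_two_dichotomy 0 p m
    have := pow_two_dichotomy 1 m p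
    have := pow_two_dichotomy 3 p k
    have := pow_two_dichotomy 2 p k
    rcases htt with rfl | ⟨i, hi1, hi2⟩
    · omega
    · have := pow_two_dichotomy 0 i m
      omega

/-- If `𝒮 ⊆ S` and `𝒯' ⊆ 𝒯` are nonempty with `𝒮 + 𝒯' = ℤ`, then `𝒯' = 𝒯`;
more precisely `𝒯'` contains `1`, `2` and `2^(n-1)` for all `n ≥ 3`. -/
theorem Tsub_eq_Tset_of_add_eq_univ (𝒮 𝒯' : Set ℤ)
    (h𝒮ne : 𝒮.Nonempty) (h𝒯ne : 𝒯'.Nonempty)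
    (h𝒮 : 𝒮 ⊆ Sset) (h𝒯 : 𝒯' ⊆ Tset)
    (hadd : 𝒮 + 𝒯' = Set.univ) :
    𝒯' = Tset ∧ (1 : ℤ) ∈ 𝒯' ∧ (2 : ℤ) ∈ 𝒯' ∧
      ∀ n : ℕ, 3 ≤ n → ((2 : ℤ) ^ (n - 1)) ∈ 𝒯' := by
  have key : ∀ (z : ℤ) (n : ℕ), (∀ (s : ℤ) (k : ℕ), s ∈ Sset → s + 2 ^ k = z → k = n) →
      (2 : ℤ) ^ n ∈ 𝒯' := by
    intro z n hz
    obtain ⟨s, hs, t, ht, hst⟩ := Set.mem_add.1 (hadd ▸ Set.mem_univ z)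
    obtain ⟨k, rfl⟩ := h𝒯 ht
    rwa [← hz s k (h𝒮 hs) hst]
  have hpow : ∀ n : ℕ, (2 : ℤ) ^ n ∈ 𝒯'
    | 0 => key (-1) 0 fun _ _ => eq_zero_of_add_two_pow_eq
    | 1 => key (-37) 1 fun _ _ => eq_one_of_add_two_pow_eq
    | 2 => key (-6) 2 fun _ _ => eq_two_of_add_two_pow_eq
    | n + 3 => key (-(5 * 2 ^ (n + 1))) (n + 3) fun _ _ =>
        eq_add_two_of_add_two_pow_eq (Nat.le_add_left 1 n)
  refine ⟨h𝒯.antisymm ?_, by simpa using hpow 0, by simpa using hpow 1, fun n _ => hpow (n - 1)⟩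
  rintro _ ⟨n, rfl⟩
  exact hpow n
end

section
/- If 𝒮 ⊆ S and 𝒯' ⊆ 𝒯 are nonempty subsets with 𝒮 + 𝒯' = ℤ, then 𝒮 contains −2 and −4, 𝒮 ⊇ {2^{n−3}+1, 2^{n−3}+2, ..., 2^{n−2}} − (1 + 2^{n+1}) for every n ≥ 3, and 𝒮 ⊇ {2^n + 2^{n−1} + 1, 2^n + 2^{n−1} + 2, ..., 2^n + 2^{n−1} + 2^{n−3}} − (1 + 2^{n+2}) for every n ≥ 3. -/
open scoped Pointwise

theorem mem_Jset_succ {n : ℕ} {x : ℤ} (hx : x ∈ Jset (n + 1)) :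
    x = 2 ^ (n + 1) - 1 ∨
      ∃ t, t + 1 ≤ n ∧ (2 : ℤ) ^ (n + 1) - 4 * 2 ^ t < x ∧ x ≤ 2 ^ (n + 1) - 3 * 2 ^ t := by
  induction n generalizing x with
  | zero =>
    left
    simpa [Jset] using hx
  | succ n ih =>
    have h₁ : (2 : ℤ) ^ (n + 1) = 2 * 2 ^ n := by ring
    have h₂ : (2 : ℤ) ^ (n + 1 + 1) = 4 * 2 ^ n := by ring
    rcases hx with ⟨hx₁, hx₂⟩ | ⟨y, hy, rfl⟩
    · exact .inr ⟨n, le_rfl, by omega, by omega⟩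
    · rcases ih hy with h | ⟨t, ht, h₃, h₄⟩
      · left
        dsimp only
        omega
      · exact .inr ⟨t, by omega, by dsimp only; omega, by dsimp only; omega⟩

/-- The shape of `u = -1 - s` for `s ∈ Sset`: apart from `u = 1`, it lies strictly between `2 ^ p`
and `2 ^ (p + 1)` in one of a few short intervals. -/
theorem shape_of_mem_Sset {s : ℤ} (hs : s ∈ Sset) :
    s = -2 ∨ ∃ (p : ℕ) (u : ℤ), s = -1 - u ∧ (2 : ℤ) ^ p < u ∧ u < 2 ^ (p + 1) ∧
      (u = 2 ^ p + 1 ∨ (3 ≤ p ∧ 14 * 2 ^ p ≤ 8 * u ∧ 8 * u < 15 * 2 ^ p) ∨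
        ∃ t, t + 4 ≤ p ∧ (2 : ℤ) ^ p + 3 * 2 ^ t ≤ u ∧ u < 2 ^ p + 4 * 2 ^ t) := by
  simp only [Sset, Set.mem_iUnion] at hs
  obtain ⟨n, k, hk, rfl⟩ := hs
  dsimp only
  match n, hk with
  | 0, hk =>
    left
    simp only [Kset, Jset, Set.mem_singleton_iff] at hk
    subst hk
    norm_num
  | 1, hk =>
    right
    simp only [Kset, Jset, Set.mem_singleton_iff] at hk
    subst hk
    exact ⟨1, 3, by norm_num⟩
  | 2, hk =>
    right
    have h3 : k = 3 := by
      rcases mem_Jset_succ hk.1 with h | ⟨t, ht, h₁, h₂⟩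
      · simpa using h
      · obtain rfl : t = 0 := by omega
        exact absurd (show k = 1 by norm_num at h₁ h₂; omega) hk.2
    subst h3
    exact ⟨2, 5, by norm_num⟩
  | n + 3, hk =>
    right
    have hn : (0 : ℤ) < 2 ^ n := by positivity
    have e1 : (2 : ℤ) ^ (n + 1) = 2 * 2 ^ n := by ring
    have e2 : (2 : ℤ) ^ (n + 2) = 4 * 2 ^ n := by ring
    have e3 : (2 : ℤ) ^ (n + 3) = 8 * 2 ^ n := by ring
    have e4 : (2 : ℤ) ^ (n + 3 + 1) = 16 * 2 ^ n := by ring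
    refine ⟨n + 3, 2 ^ (n + 3 + 1) - k, by ring, ?_⟩
    rcases hk with ⟨h₁, h₂⟩ | ⟨x, hx, rfl⟩
    · exact ⟨by omega, by omega, .inr (.inl ⟨by omega, by omega, by omega⟩)⟩
    · dsimp only
      rcases mem_Jset_succ hx with h | ⟨t, ht, h₁, h₂⟩
      · exact ⟨by omega, by omega, .inl (by omega)⟩
      · have hp : (0 : ℤ) < 2 ^ t := by positivity
        have hle : (2 : ℤ) ^ (t + 1) ≤ 2 ^ n := pow_le_pow_right₀ (by norm_num) ht
        rw [pow_succ] at hle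
        exact ⟨by omega, by omega, .inr (.inr ⟨t, by omega, by omega, by omega⟩)⟩

theorem exponent_eq_of_mem_dyadic_interval {p a : ℕ} {u : ℤ} (h₁ : (2 : ℤ) ^ p ≤ u)
    (h₂ : u < 2 ^ (p + 1)) (h₃ : (2 : ℤ) ^ a ≤ u) (h₄ : u < 2 ^ (a + 1)) : p = a := by
  have h₅ := (pow_lt_pow_iff_right₀ (by norm_num : (1 : ℤ) < 2)).1 (h₁.trans_lt h₄)
  have h₆ := (pow_lt_pow_iff_right₀ (by norm_num : (1 : ℤ) < 2)).1 (h₃.trans_lt h₂)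
  omega

theorem eq_neg_two_of_add_two_pow {s : ℤ} {m : ℕ} (hs : s ∈ Sset) (h : s + 2 ^ m = -1) :
    s = -2 := by
  rcases shape_of_mem_Sset hs with rfl | ⟨p, u, rfl, h₁, h₂, -⟩
  · rfl
  · obtain rfl : u = 2 ^ m := by omega
    have := exponent_eq_of_mem_dyadic_interval h₁.le h₂ le_rfl
      (pow_lt_pow_right₀ (by norm_num) (Nat.lt_succ_self m))
    subst this
    exact absurd h₁ (lt_irrefl _)

theorem eq_neg_four_of_add_two_pow {s : ℤ} {m : ℕ} (hs : s ∈ Sset) (h : s + 2 ^ m = -3) :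
    s = -4 := by
  rcases shape_of_mem_Sset hs with rfl | ⟨p, u, rfl, h₁, h₂, h₃⟩
  · have : (0 : ℤ) < 2 ^ m := by positivity
    omega
  · obtain rfl : u = 2 ^ m + 2 := by omega
    match m with
    | 0 => norm_num
    | 1 =>
      norm_num at h₁ h₂
      have := exponent_eq_of_mem_dyadic_interval (a := 2) h₁.le h₂ (by norm_num) (by norm_num)
      subst this
      norm_num at h₁
    | m + 2 =>
      have hm : (0 : ℤ) < 2 ^ m := by positivity
      have e2 : (2 : ℤ) ^ (m + 2) = 4 * 2 ^ m := by ring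
      have e3 : (2 : ℤ) ^ (m + 2 + 1) = 8 * 2 ^ m := by ring
      have := exponent_eq_of_mem_dyadic_interval (a := m + 2) h₁.le h₂ (by omega) (by omega)
      subst this
      rcases h₃ with h₃ | ⟨h₀, h₃, -⟩ | ⟨t, -, h₃, -⟩
      · omega
      · have : (2 : ℤ) ^ 3 ≤ 2 ^ (m + 2) := pow_le_pow_right₀ (by norm_num) h₀
        omega
      · have : (0 : ℤ) < 2 ^ t := by positivity
        omega

theorem eq_or_eq_of_add_two_pow {s k : ℤ} {m r : ℕ} (hs : s ∈ Sset) (hk₁ : 1 ≤ k)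
    (hk₂ : k ≤ 2 * 2 ^ r) (h : s + 2 ^ m = k - 1 - 12 * 2 ^ r) :
    (m = r + 2 ∧ 2 ^ r < k) ∨ (m = r + 3 ∧ k ≤ 2 ^ r) := by
  have hr : (0 : ℤ) < 2 ^ r := by positivity
  have hm : (0 : ℤ) < 2 ^ m := by positivity
  have e2 : (2 : ℤ) ^ (r + 2) = 4 * 2 ^ r := by ring
  have e3 : (2 : ℤ) ^ (r + 3) = 8 * 2 ^ r := by ring
  have e4 : (2 : ℤ) ^ (r + 3 + 1) = 16 * 2 ^ r := by ring
  have e4' : (2 : ℤ) ^ (r + 4) = 16 * 2 ^ r := by ring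
  have e5 : (2 : ℤ) ^ (r + 4 + 1) = 32 * 2 ^ r := by ring
  rcases shape_of_mem_Sset hs with rfl | ⟨p, u, rfl, h₁, h₂, h₃⟩
  · omega
  have hu : u = 12 * 2 ^ r - k + 2 ^ m := by omega
  have pow_dichotomy (t c : ℕ) : (2 : ℤ) ^ t ≤ 2 ^ c ∨ (2 : ℤ) ^ (c + 1) ≤ 2 ^ t := by
    rcases Nat.lt_or_ge c t with h | h
    · exact .inr (pow_le_pow_right₀ (by norm_num) h)
    · exact .inl (pow_le_pow_right₀ (by norm_num) h)
  rcases Nat.lt_or_ge m (r + 3) with hlt | hge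
  · have hle : (2 : ℤ) ^ m ≤ 2 ^ (r + 2) := pow_le_pow_right₀ (by norm_num) (by omega)
    obtain rfl := exponent_eq_of_mem_dyadic_interval (a := r + 3) h₁.le h₂ (by omega) (by omega)
    rcases h₃ with h₃ | ⟨-, h₃, h₄⟩ | ⟨t, ht, h₃, h₄⟩
    · omega
    · rcases pow_dichotomy m (r + 1) with h | h
      · have : (2 : ℤ) ^ (r + 1) = 2 * 2 ^ r := by ring
        omega
      · have := (pow_le_pow_iff_right₀ (by norm_num : (1 : ℤ) < 2)).1 h
        obtain rfl : m = r + 2 := by omega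
        exact .inl ⟨rfl, by omega⟩
    · have hle : (2 : ℤ) ^ (t + 1) ≤ 2 ^ r := pow_le_pow_right₀ (by norm_num) (by omega)
      rw [pow_succ] at hle
      omega
  · rcases Nat.lt_or_ge m (r + 5) with hlt | hge
    · obtain rfl | rfl : m = r + 3 ∨ m = r + 4 := by omega
      all_goals
        obtain rfl := exponent_eq_of_mem_dyadic_interval (a := r + 4) h₁.le h₂ (by omega) (by omega)
        rcases h₃ with h₃ | ⟨-, h₃, h₄⟩ | ⟨t, ht, h₃, h₄⟩
        · omega
        · omega
        · obtain rfl | hlt : t = r ∨ t < r := by omega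
          · omega
          · have hle : (2 : ℤ) ^ (t + 1) ≤ 2 ^ r := pow_le_pow_right₀ (by norm_num) hlt
            rw [pow_succ] at hle
            omega
    · have hle : (2 : ℤ) ^ (r + 4 + 1) ≤ 2 ^ m := pow_le_pow_right₀ (by norm_num) hge
      obtain rfl := exponent_eq_of_mem_dyadic_interval (a := m) h₁.le h₂ (by omega)
        (by rw [pow_succ]; omega)
      rcases h₃ with h₃ | ⟨-, h₃, h₄⟩ | ⟨t, ht, h₃, h₄⟩
      · omega
      · omega
      · rcases pow_dichotomy t (r + 1) with h | h
        · have : (2 : ℤ) ^ (r + 1) = 2 * 2 ^ r := by ring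
          omega
        · have : (2 : ℤ) ^ (r + 1 + 1) = 4 * 2 ^ r := by ring
          omega

/-- If `𝒮 ⊆ S` and `𝒯' ⊆ 𝒯` are nonempty with `𝒮 + 𝒯' = ℤ`, then `𝒮` contains
`−2`, `−4`, the sets `{2^(n−3)+1, ..., 2^(n−2)} − (1 + 2^(n+1))` for `n ≥ 3`, and the
sets `{2^n + 2^(n−1) + 1, ..., 2^n + 2^(n−1) + 2^(n−3)} − (1 + 2^(n+2))` for `n ≥ 3`. -/
theorem Ssub_contains_required_clusters (𝒮 𝒯' : Set ℤ)
    (h𝒮ne : 𝒮.Nonempty) (h𝒯ne : 𝒯'.Nonempty)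
    (h𝒮 : 𝒮 ⊆ Sset) (h𝒯 : 𝒯' ⊆ Tset)
    (hadd : 𝒮 + 𝒯' = Set.univ) :
    (-2 : ℤ) ∈ 𝒮 ∧ (-4 : ℤ) ∈ 𝒮 ∧
      (∀ n : ℕ, 3 ≤ n → ∀ k : ℤ,
        (2 : ℤ) ^ (n - 3) + 1 ≤ k → k ≤ (2 : ℤ) ^ (n - 2) →
          k - (1 + 2 ^ (n + 1)) ∈ 𝒮) ∧
      (∀ n : ℕ, 3 ≤ n → ∀ k : ℤ,
        (2 : ℤ) ^ n + (2 : ℤ) ^ (n - 1) + 1 ≤ k →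
          k ≤ (2 : ℤ) ^ n + (2 : ℤ) ^ (n - 1) + (2 : ℤ) ^ (n - 3) →
          k - (1 + 2 ^ (n + 2)) ∈ 𝒮) := by
  have rep (z : ℤ) : ∃ s ∈ 𝒮, ∃ m : ℕ, s + 2 ^ m = z := by
    obtain ⟨s, hs, t, ht, hst⟩ : z ∈ 𝒮 + 𝒯' := hadd ▸ Set.mem_univ z
    obtain ⟨m, rfl⟩ := h𝒯 ht
    exact ⟨s, hs, m, hst⟩
  refine ⟨?_, ?_, fun n hn k hk₁ hk₂ => ?_, fun n hn k hk₁ hk₂ => ?_⟩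
  · obtain ⟨s, hs, m, h⟩ := rep (-1)
    exact eq_neg_two_of_add_two_pow (h𝒮 hs) h ▸ hs
  · obtain ⟨s, hs, m, h⟩ := rep (-3)
    exact eq_neg_four_of_add_two_pow (h𝒮 hs) h ▸ hs
  all_goals
    obtain ⟨r, rfl⟩ := Nat.exists_eq_add_of_le' hn
    have hr : (0 : ℤ) < 2 ^ r := by positivity
    have e1 : (2 : ℤ) ^ (r + 1) = 2 * 2 ^ r := by ring
    have e2 : (2 : ℤ) ^ (r + 2) = 4 * 2 ^ r := by ring
    have e3 : (2 : ℤ) ^ (r + 3) = 8 * 2 ^ r := by ring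
    have e4 : (2 : ℤ) ^ (r + 3 + 1) = 16 * 2 ^ r := by ring
    have e5 : (2 : ℤ) ^ (r + 3 + 2) = 32 * 2 ^ r := by ring
    simp only [show r + 3 - 3 = r by omega, show r + 3 - 2 = r + 1 by omega,
      show r + 3 - 1 = r + 2 by omega] at hk₁ hk₂
  · obtain ⟨s, hs, m, h⟩ := rep (k - 1 - 12 * 2 ^ r)
    rcases eq_or_eq_of_add_two_pow (h𝒮 hs) (by omega) (by omega) h with ⟨rfl, -⟩ | ⟨-, hk⟩
    · convert hs using 1
      omega
    · omega
  · obtain ⟨s, hs, m, h⟩ := rep (k - 12 * 2 ^ r - 1 - 12 * 2 ^ r)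
    rcases eq_or_eq_of_add_two_pow (h𝒮 hs) (by omega) (by omega) h with ⟨-, hk⟩ | ⟨rfl, -⟩
    · omega
    · convert hs using 1
      omega
end

section
/- U + 𝒱 = ℤ, i.e., 𝒱 is an additive complement of U in ℤ: every integer can be written as u + v with u ∈ U and v ∈ 𝒱. -/
open scoped Pointwise

/-- `𝒱 = {2^n : n ≥ 0} ∪ {−2^n : n ≥ 0}`. -/
def Vset : Set ℤ := {x | ∃ n : ℕ, x = 2 ^ n ∨ x = -(2 ^ n)}

/-- The sets `U_n`: `U_0 = {−2, −1}`, `U_1 = U_2 = ∅`, `U_3 = {6} − (1 + 2^4)`,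
`U_4 = {3, 4, 14} − (1 + 2^5)`, and for `n ≥ 5`,
`U_n = ((2^(n−3) + {1, ..., 2^(n−3)}) ∪ (2^(n−1) + 2^(n−2) + {1, ..., 2^(n−4)})) − (1 + 2^(n+1))`. -/
def Useq : ℕ → Set ℤ
  | 0 => {-2, -1}
  | 1 => ∅
  | 2 => ∅
  | 3 => {6 - (1 + 2 ^ 4)}
  | 4 => (fun x => x - (1 + 2 ^ 5)) '' {3, 4, 14}
  | n + 5 => (fun x => x - (1 + 2 ^ (n + 6))) ''
      (Set.Icc ((2 : ℤ) ^ (n + 2) + 1) (2 ^ (n + 2) + 2 ^ (n + 2)) ∪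
       Set.Icc ((2 : ℤ) ^ (n + 4) + 2 ^ (n + 3) + 1) (2 ^ (n + 4) + 2 ^ (n + 3) + 2 ^ (n + 1)))

/-- `U = ⋃_{n ≥ 0} U_n`. -/
def Uset : Set ℤ := ⋃ n, Useq n

lemma mem_add_Vset_of_sub_two_pow {A : Set ℤ} {x : ℤ} (k : ℕ) (h : x - 2 ^ k ∈ A) :
    x ∈ A + Vset :=
  Set.mem_add.2 ⟨_, h, 2 ^ k, ⟨k, Or.inl rfl⟩, by ring⟩

lemma mem_add_Vset_of_add_two_pow {A : Set ℤ} {x : ℤ} (k : ℕ) (h : x + 2 ^ k ∈ A) :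
    x ∈ A + Vset :=
  Set.mem_add.2 ⟨_, h, -2 ^ k, ⟨k, Or.inr rfl⟩, by ring⟩

/-- The first block of `U_{k+5}`, an interval of integers. -/
lemma mem_Uset_of_mem_lower_block {u : ℤ} (k : ℕ) (h₁ : -(60 * 2 ^ k) ≤ u)
    (h₂ : u < -(56 * 2 ^ k)) : u ∈ Uset := by
  refine Set.mem_iUnion.2 ⟨k + 5, u + (1 + 2 ^ (k + 6)), Or.inl ⟨?_, ?_⟩, by ring⟩ <;>
    simp only [pow_add] <;> linarith

/-- The second block of `U_{k+5}`, an interval of integers. -/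
lemma mem_Uset_of_mem_upper_block {u : ℤ} (k : ℕ) (h₁ : -(40 * 2 ^ k) ≤ u)
    (h₂ : u < -(38 * 2 ^ k)) : u ∈ Uset := by
  refine Set.mem_iUnion.2 ⟨k + 5, u + (1 + 2 ^ (k + 6)), Or.inr ⟨?_, ?_⟩, by ring⟩ <;>
    simp only [pow_add] <;> linarith

lemma mem_Uset_of_mem_small {u : ℤ}
    (h : u ∈ ([-2, -1, -11, -30, -29, -19, -60, -59, -58, -57, -40, -39,
      -80, -79, -78, -77] : List ℤ)) : u ∈ Uset := by
  have h₀ : Useq 0 ⊆ Uset := Set.subset_iUnion _ 0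
  have h₃ : Useq 3 ⊆ Uset := Set.subset_iUnion _ 3
  have h₄ : Useq 4 ⊆ Uset := Set.subset_iUnion _ 4
  simp only [List.mem_cons, List.not_mem_nil, or_false] at h
  rcases h with rfl | rfl | rfl | rfl | rfl | rfl | rfl | rfl | rfl | rfl | rfl | rfl | rfl |
    rfl | rfl | rfl <;>
  first
  | exact mem_Uset_of_mem_lower_block 0 (by lia) (by lia)
  | exact mem_Uset_of_mem_upper_block 0 (by lia) (by lia)
  | exact mem_Uset_of_mem_upper_block 1 (by lia) (by lia)
  | (apply h₀; simp [Useq]; done)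
  | (apply h₃; simp [Useq]; done)
  | (apply h₄; simp [Useq])

lemma mem_Uset_add_Vset_of_small {x : ℤ} (h₁ : -64 ≤ x) (h₂ : x < 4) : x ∈ Uset + Vset := by
  have key : ∀ y ∈ Finset.Ico (-64 : ℤ) 4, ∃ k ∈ Finset.range 7,
      y - 2 ^ k ∈ ([-2, -1, -11, -30, -29, -19, -60, -59, -58, -57, -40, -39,
        -80, -79, -78, -77] : List ℤ) ∨
      y + 2 ^ k ∈ ([-2, -1, -11, -30, -29, -19, -60, -59, -58, -57, -40, -39,
        -80, -79, -78, -77] : List ℤ) := by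
    decide +kernel
  obtain ⟨k, -, hk | hk⟩ := key x (Finset.mem_Ico.2 ⟨h₁, h₂⟩)
  · exact mem_add_Vset_of_sub_two_pow k (mem_Uset_of_mem_small hk)
  · exact mem_add_Vset_of_add_two_pow k (mem_Uset_of_mem_small hk)

lemma exists_two_pow_le_lt {y : ℤ} (hy : 1 ≤ y) : ∃ m : ℕ, 2 ^ m ≤ y ∧ y < 2 * 2 ^ m := by
  lift y to ℕ using by omega
  refine ⟨Nat.log 2 y, ?_, ?_⟩
  · exact_mod_cast Nat.pow_log_le_self 2 (by omega)
  · rw [mul_comm, ← pow_succ]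
    exact_mod_cast Nat.lt_pow_succ_log_self one_lt_two y

lemma mem_Uset_add_Vset_of_four_le {x : ℤ} (hx : 4 ≤ x) : x ∈ Uset + Vset := by
  obtain ⟨m, h₁, h₂⟩ := exists_two_pow_le_lt (y := x / 4) (by omega)
  refine mem_add_Vset_of_sub_two_pow (m + 6) (mem_Uset_of_mem_lower_block m ?_ ?_) <;>
    rw [pow_add] <;> omega

lemma mem_Uset_add_Vset_of_lt_neg {x : ℤ} (hx : x < -64) : x ∈ Uset + Vset := by
  obtain ⟨m, h₁, h₂⟩ := exists_two_pow_le_lt (y := (-x - 1) / 64) (by omega)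
  have hm : (0 : ℤ) < 2 ^ m := by positivity
  have lower := fun u : ℤ => @mem_Uset_of_mem_lower_block u (m + 1)
  have upper := fun u : ℤ => @mem_Uset_of_mem_upper_block u (m + 1)
  have lower' := fun u : ℤ => @mem_Uset_of_mem_lower_block u m
  have upper' := fun u : ℤ => @mem_Uset_of_mem_upper_block u (m + 2)
  have sub := fun k : ℕ => @mem_add_Vset_of_sub_two_pow Uset x k
  have add := fun k : ℕ => @mem_add_Vset_of_add_two_pow Uset x k
  have sub₀ := sub 0
  have add₀ := add 0
  have sub₂ := sub (m + 2)
  have sub₃ := sub (m + 3)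
  have sub₄ := sub (m + 4)
  have sub₆ := sub (m + 6)
  have add₂ := add (m + 2)
  have add₃ := add (m + 3)
  simp only [pow_add, pow_zero] at *
  generalize (2 : ℤ) ^ m = p at *
  rcases lt_or_ge x (-(120 * p)) with h | h
  · exact add₃ (lower _ (by omega) (by omega))
  rcases lt_or_ge x (-(112 * p)) with h | h
  · by_cases h' : x = -(120 * p)
    · exact add₀ (lower _ (by omega) (by omega))
    · exact sub₀ (lower _ (by omega) (by omega))
  rcases lt_or_ge x (-(104 * p)) with h | h
  · exact sub₃ (lower _ (by omega) (by omega))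
  rcases lt_or_ge x (-(96 * p)) with h | h
  · exact sub₄ (lower _ (by omega) (by omega))
  rcases lt_or_ge x (-(88 * p)) with h | h
  · exact sub₆ (upper' _ (by omega) (by omega))
  rcases lt_or_ge x (-(84 * p)) with h | h
  · exact add₃ (upper _ (by omega) (by omega))
  rcases lt_or_ge x (-(80 * p)) with h | h
  · exact add₂ (upper _ (by omega) (by omega))
  rcases lt_or_ge x (-(76 * p)) with h | h
  · by_cases h' : x = -(80 * p)
    · exact add₀ (upper _ (by omega) (by omega))
    · exact sub₀ (upper _ (by omega) (by omega))
  rcases lt_or_ge x (-(72 * p)) with h | h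
  · exact sub₂ (upper _ (by omega) (by omega))
  rcases lt_or_ge x (-(68 * p)) with h | h
  · exact sub₃ (upper _ (by omega) (by omega))
  · exact add₃ (lower' _ (by omega) (by omega))

/-- `𝒱` is an additive complement of `U` in `ℤ`: `U + 𝒱 = ℤ`. -/
theorem Uset_add_Vset_eq_univ : Uset + Vset = Set.univ := by
  refine Set.eq_univ_of_forall fun x => ?_
  rcases lt_or_ge x (-64) with h | h
  · exact mem_Uset_add_Vset_of_lt_neg h
  rcases lt_or_ge x 4 with h' | h'
  · exact mem_Uset_add_Vset_of_small h h'
  · exact mem_Uset_add_Vset_of_four_le h'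
end

section
/- For every n ≥ 6, the integer 2^n − 2 − (1 + 2^{n+1}) (i.e., −2^n − 3) does not belong to U + (𝒱 \ {−2^{n−3}}). -/
open scoped Pointwise

/-- Consecutive powers of two are separated by a factor of two. -/
theorem two_pow_le_or_two_mul_two_pow_le (p k : ℕ) :
    (p ≤ k ∧ (2 : ℤ) ^ p ≤ 2 ^ k) ∨ (k < p ∧ 2 * (2 : ℤ) ^ k ≤ 2 ^ p) := by
  rcases Nat.lt_or_ge k p with h | h
  · exact .inr ⟨h, by
      rw [← pow_succ']
      exact pow_le_pow_right₀ (by norm_num) h⟩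
  · exact .inl ⟨h, pow_le_pow_right₀ (by norm_num) h⟩

theorem two_pow_trichotomy (p k : ℕ) :
    (p < k ∧ 2 * (2 : ℤ) ^ p ≤ 2 ^ k) ∨ (p = k ∧ (2 : ℤ) ^ p = 2 ^ k) ∨
      (k < p ∧ 2 * (2 : ℤ) ^ k ≤ 2 ^ p) := by
  rcases two_pow_le_or_two_mul_two_pow_le p k with ⟨h, -⟩ | h
  · rcases h.eq_or_lt with rfl | h
    · exact .inr (.inl ⟨rfl, rfl⟩)
    · rcases two_pow_le_or_two_mul_two_pow_le k p with h' | h'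
      · omega
      · exact .inl h'
  · exact .inr (.inr h)

/-- A sum of two powers of two, one of which is at least `2 ^ 6`, avoids the intervals
`[28a - 2, 30a - 3]` and `[19a - 2, 20a - 3]` for `a = 2 ^ (k + 1)`. -/
theorem two_pow_add_two_pow_avoids_intervals {n : ℕ} (hn : 6 ≤ n) (p k : ℕ) :
    ¬ ((28 * 2 ^ (k + 1) - 2 ≤ (2 : ℤ) ^ n + 2 ^ p ∧ (2 : ℤ) ^ n + 2 ^ p ≤ 30 * 2 ^ (k + 1) - 3) ∨
      (19 * 2 ^ (k + 1) - 2 ≤ (2 : ℤ) ^ n + 2 ^ p ∧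
        (2 : ℤ) ^ n + 2 ^ p ≤ 20 * 2 ^ (k + 1) - 3)) := by
  have ha := two_pow_trichotomy k 0
  have hN : (0 : ℤ) < 2 ^ n := by positivity
  have hP : (0 : ℤ) < 2 ^ p := by positivity
  have n5 := two_pow_trichotomy n (k + 5)
  have p5 := two_pow_trichotomy p (k + 5)
  have n2 := two_pow_le_or_two_mul_two_pow_le n (k + 2)
  have p2 := two_pow_le_or_two_mul_two_pow_le p (k + 2)
  simp only [pow_add] at *
  norm_num at ha n5 p5 n2 p2 ⊢
  omega

/-- A difference of two powers of two meets the intervals `[28a - 2, 30a - 3]` and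
`[19a - 2, 20a - 3]`, for `a = 2 ^ (k + 1)`, only at `28a`. -/
theorem eq_add_three_of_two_pow_sub_two_pow {n p k : ℕ}
    (h : (28 * 2 ^ (k + 1) - 2 ≤ (2 : ℤ) ^ n - 2 ^ p ∧ (2 : ℤ) ^ n - 2 ^ p ≤ 30 * 2 ^ (k + 1) - 3) ∨
      (19 * 2 ^ (k + 1) - 2 ≤ (2 : ℤ) ^ n - 2 ^ p ∧
        (2 : ℤ) ^ n - 2 ^ p ≤ 20 * 2 ^ (k + 1) - 3)) : n = p + 3 := by
  have ha : (0 : ℤ) < 2 ^ k := by positivity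
  have hP : (0 : ℤ) < 2 ^ p := by positivity
  have np := two_pow_trichotomy n p
  have n6 := two_pow_trichotomy n (k + 6)
  have p3 := two_pow_trichotomy p (k + 3)
  have p4 := two_pow_le_or_two_mul_two_pow_le p (k + 4)
  simp only [pow_add] at *
  norm_num at h n6 p3 p4
  omega

theorem two_pow_ne_two_pow_sub {n : ℕ} (hn : 6 ≤ n) (p : ℕ) {c : ℤ} (hc : c ≠ 0)
    (hc₁ : -64 < c) (hc₂ : c < 32) : (2 : ℤ) ^ p ≠ 2 ^ n - c := by
  have hN : (2 : ℤ) ^ 6 ≤ 2 ^ n := pow_le_pow_right₀ (by norm_num) hn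
  have := two_pow_trichotomy p n
  omega

theorem mem_Useq_add_five {k : ℕ} {u : ℤ} (hu : u ∈ Useq (k + 5)) :
    (-(30 * 2 ^ (k + 1)) ≤ u ∧ u ≤ -(28 * 2 ^ (k + 1)) - 1) ∨
      (-(20 * 2 ^ (k + 1)) ≤ u ∧ u ≤ -(19 * 2 ^ (k + 1)) - 1) := by
  simp only [Useq, Set.mem_image, Set.mem_union, Set.mem_Icc, pow_add] at hu
  obtain ⟨x, hx, rfl⟩ := hu
  simp only [pow_add]
  omega

/-- For `n ≥ 6`, the integer `2^n − 2 − (1 + 2^(n+1)) = −2^n − 3` does not belong to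
`U + (𝒱 \ {−2^(n−3)})`. -/
theorem not_mem_Uset_add_Vset_sans_neg_pow (n : ℕ) (hn : 6 ≤ n) :
    ((2 : ℤ) ^ n - 2 - (1 + 2 ^ (n + 1))) ∉ Uset + (Vset \ {-(2 : ℤ) ^ (n - 3)}) := by
  rintro ⟨u, hu, v, ⟨⟨p, hv⟩, hne⟩, huv⟩
  obtain ⟨m, hu⟩ := Set.mem_iUnion.mp hu
  have hN : (2 : ℤ) ^ 6 ≤ 2 ^ n := pow_le_pow_right₀ (by norm_num) hn
  have hP : (0 : ℤ) < 2 ^ p := by positivity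
  have hsum : u + v = -2 ^ n - 3 := by
    rw [show u + v = _ from huv, pow_succ]
    ring
  have small : ∀ c : ℤ, u = -3 - c → c ≠ 0 → -64 < c → c < 32 → False := by
    intro c hu hc hc₁ hc₂
    have := two_pow_ne_two_pow_sub hn p hc hc₁ hc₂
    omega
  match m, hu with
  | 0, hu =>
    rcases hu with rfl | rfl
    · exact small (-1) (by norm_num) (by norm_num) (by norm_num) (by norm_num)
    · exact small (-2) (by norm_num) (by norm_num) (by norm_num) (by norm_num)
  | 1, hu => exact hu
  | 2, hu => exact hu
  | 3, hu =>
    obtain rfl : u = _ := hu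
    exact small 8 (by norm_num) (by norm_num) (by norm_num) (by norm_num)
  | 4, hu =>
    obtain ⟨x, rfl | rfl | rfl, rfl⟩ := hu
    · exact small 27 (by norm_num) (by norm_num) (by norm_num) (by norm_num)
    · exact small 26 (by norm_num) (by norm_num) (by norm_num) (by norm_num)
    · exact small 16 (by norm_num) (by norm_num) (by norm_num) (by norm_num)
  | k + 5, hu =>
    have hu := mem_Useq_add_five hu
    rcases hv with rfl | rfl
    · exact two_pow_add_two_pow_avoids_intervals hn p k (by omega)
    · obtain rfl : n = p + 3 := eq_add_three_of_two_pow_sub_two_pow (k := k) (by omega)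
      exact hne (by simp)
end

section
/- For every n ≥ 4, the interval {−2^{n−3}, −2^{n−3}+1, ..., −1, 0, 1, ..., 2^{n−3}−1} of ℤ is disjoint from (⋃_{m ≥ n} U_m) + 𝒱. Consequently, for every integer y, there are only finitely many pairs (u, v) ∈ U × 𝒱 with y = u + v. -/
open scoped Pointwise

/-- For `y` in the interval of radius `2^(m-3)` around `0` and `u ∈ U_m`, the difference `y - u`
lies strictly between two consecutive powers of two. -/
theorem sub_mem_Ioo_of_mem_Useq {m : ℕ} (hm : 4 ≤ m) {u y : ℤ} (hu : u ∈ Useq m)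
    (hy : y ∈ Set.Icc (-(2 : ℤ) ^ (m - 3)) (2 ^ (m - 3) - 1)) :
    y - u ∈ Set.Ioo ((2 : ℤ) ^ m) (2 ^ (m + 1)) := by
  match m, hm, hu, hy with
  | 4, _, hu, hy =>
    simp only [Useq, Set.mem_image, Set.mem_insert_iff, Set.mem_singleton_iff] at hu
    obtain ⟨x, hx, rfl⟩ := hu
    norm_num at hy ⊢
    omega
  | n + 5, _, hu, hy =>
    obtain ⟨x, hx, rfl⟩ := hu
    have hpos : (0 : ℤ) < 2 ^ n := by positivity
    simp only [Set.mem_union, Set.mem_Icc, Set.mem_Ioo, show n + 5 - 3 = n + 2 by omega,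
      show n + 5 + 1 = n + 6 by omega, pow_add] at hx hy ⊢
    omega

theorem two_pow_notMem_Ioo (m k : ℕ) : (2 : ℤ) ^ k ∉ Set.Ioo ((2 : ℤ) ^ m) (2 ^ (m + 1)) := by
  rintro ⟨h₁, h₂⟩
  have h₁' := (pow_lt_pow_iff_right₀ (one_lt_two (α := ℤ))).1 h₁
  have h₂' := (pow_lt_pow_iff_right₀ (one_lt_two (α := ℤ))).1 h₂
  omega

theorem notMem_Ioo_of_mem_Vset {v : ℤ} (hv : v ∈ Vset) (m : ℕ) :
    v ∉ Set.Ioo ((2 : ℤ) ^ m) (2 ^ (m + 1)) := by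
  obtain ⟨k, rfl | rfl⟩ := hv
  · exact two_pow_notMem_Ioo m k
  · rintro ⟨h, -⟩
    have hm : (0 : ℤ) < 2 ^ m := by positivity
    have hk : (0 : ℤ) < 2 ^ k := by positivity
    omega

theorem add_notMem_Icc_of_mem_Useq {n m : ℕ} (hn : 4 ≤ n) (hnm : n ≤ m) {u v : ℤ}
    (hu : u ∈ Useq m) (hv : v ∈ Vset) :
    u + v ∉ Set.Icc (-(2 : ℤ) ^ (n - 3)) (2 ^ (n - 3) - 1) := by
  intro hy
  have hpow : (2 : ℤ) ^ (n - 3) ≤ 2 ^ (m - 3) :=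
    pow_le_pow_right₀ one_le_two (Nat.sub_le_sub_right hnm 3)
  have hmem := sub_mem_Ioo_of_mem_Useq (hn.trans hnm) hu
    (Set.Icc_subset_Icc (neg_le_neg hpow) (sub_le_sub_right hpow 1) hy)
  rw [add_sub_cancel_left] at hmem
  exact notMem_Ioo_of_mem_Vset hv m hmem

theorem finite_Useq : ∀ n : ℕ, (Useq n).Finite
  | 0 => Set.toFinite {-2, -1}
  | 1 => Set.finite_empty
  | 2 => Set.finite_empty
  | 3 => Set.finite_singleton _
  | 4 => (Set.toFinite {3, 4, 14}).image _
  | _ + 5 => ((Set.finite_Icc _ _).union (Set.finite_Icc _ _)).image _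

/-- For `n ≥ 4`, the interval `{−2^(n−3), ..., 2^(n−3) − 1}` is disjoint from
`(⋃_{m ≥ n} U_m) + 𝒱`; consequently every integer `y` has only finitely many
representations `y = u + v` with `(u, v) ∈ U × 𝒱`. -/
theorem interval_disjoint_and_finitely_many_representations :
    (∀ n : ℕ, 4 ≤ n →
      Set.Icc (-(2 : ℤ) ^ (n - 3)) ((2 : ℤ) ^ (n - 3) - 1) ∩
        ((⋃ m : ℕ, ⋃ (_ : n ≤ m), Useq m) + Vset) = ∅) ∧
    ∀ y : ℤ, {p : ℤ × ℤ | p.1 ∈ Uset ∧ p.2 ∈ Vset ∧ y = p.1 + p.2}.Finite := by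
  refine ⟨fun n hn => Set.eq_empty_of_forall_notMem ?_, fun y => ?_⟩
  · rintro _ ⟨hy, u, hu, v, hv, rfl⟩
    simp only [Set.mem_iUnion] at hu
    obtain ⟨m, hnm, hu⟩ := hu
    exact add_notMem_Icc_of_mem_Useq hn hnm hu hv hy
  · have hlt : |y| < (2 : ℤ) ^ (y.natAbs + 1) := by
      have h : y.natAbs < 2 ^ (y.natAbs + 1) :=
        Nat.lt_two_pow_self.trans (Nat.pow_lt_pow_succ one_lt_two)
      rw [Int.abs_eq_natAbs]
      exact_mod_cast h
    have hfin : (⋃ m ∈ Set.Iio (y.natAbs + 4), Useq m).Finite :=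
      (Set.finite_Iio _).biUnion fun m _ => finite_Useq m
    refine (hfin.image fun u => (u, y - u)).subset ?_
    rintro ⟨u, v⟩ ⟨hu, hv, hy⟩
    dsimp only at hu hv hy
    obtain ⟨m, hu⟩ := Set.mem_iUnion.1 hu
    refine ⟨u, Set.mem_biUnion (Set.mem_Iio.2 ?_) hu, by simp [hy]⟩
    by_contra! hm
    refine add_notMem_Icc_of_mem_Useq (by omega) hm hu hv ?_
    rw [← hy, show y.natAbs + 4 - 3 = y.natAbs + 1 by omega]
    rw [abs_lt] at hlt
    exact ⟨hlt.1.le, Int.le_sub_one_of_lt hlt.2⟩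
end

section
/- Let H be a subgroup of an abelian group G. Let (A, B) be a co-minimal pair in H, and let C, D be subsets of G such that the images of C and D under the quotient map π: G → G/H form a co-minimal pair in G/H, and π restricted to C and to D is injective. Then (A + C, B + D) is a co-minimal pair in G. -/
open scoped Pointwise

/-- If `A` is minimal among the nonempty sets `A'` with `A' + B = S`, then every `a₀ ∈ A` is
forced: some element of `S` is a sum of elements of `A` and `B` only through `a₀`. -/
theorem exists_forall_add_eq_imp_eq {G : Type*} [AddCommGroup G] {A B S : Set G}
    (hS : S.Nonempty) (hAB : A + B = S)
    (hmin : ∀ A' : Set G, A'.Nonempty → A' ⊂ A → A' + B ≠ S) {a₀ : G} (ha₀ : a₀ ∈ A) :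
    ∃ h ∈ S, ∀ a ∈ A, ∀ b ∈ B, a + b = h → a = a₀ := by
  by_contra! hcon
  have hsub : A \ {a₀} ⊂ A := Set.sdiff_singleton_ssubset.2 ha₀
  obtain ⟨s, hs⟩ := hS
  obtain ⟨a, ha, -, -, -, hne⟩ := hcon s hs
  refine hmin (A \ {a₀}) ⟨a, ha, hne⟩ hsub (Set.Subset.antisymm ?_ fun x hx => ?_)
  · exact hAB ▸ Set.add_subset_add_right hsub.subset
  · obtain ⟨a, ha, b, hb, hab, hne⟩ := hcon x hx
    exact ⟨a, ⟨ha, hne⟩, b, hb, hab⟩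

/-- Minimality of `A` in a subgroup `H` and of the image of `C` in `G ⧸ H` together give
minimality of `A + C`. -/
theorem add_ne_univ_of_ssubset_add {G : Type*} [AddCommGroup G] {H : AddSubgroup G}
    {A B C D : Set G} (hA : A ⊆ (H : Set G)) (hB : B ⊆ (H : Set G))
    (hAB : A + B = (H : Set G))
    (hAmin : ∀ A' : Set G, A'.Nonempty → A' ⊂ A → A' + B ≠ (H : Set G))
    (hCD : (QuotientAddGroup.mk '' C : Set (G ⧸ H)) + QuotientAddGroup.mk '' D = Set.univ)
    (hCmin : ∀ C' : Set (G ⧸ H), C'.Nonempty → C' ⊂ QuotientAddGroup.mk '' C →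
      C' + QuotientAddGroup.mk '' D ≠ Set.univ)
    (hCinj : Set.InjOn (QuotientAddGroup.mk (s := H)) C)
    (hDinj : Set.InjOn (QuotientAddGroup.mk (s := H)) D)
    {S : Set G} (hS : S ⊂ A + C) : S + (B + D) ≠ Set.univ := by
  intro hcover
  obtain ⟨hsub, x, ⟨a₀, ha₀, c₀, hc₀, rfl⟩, hx⟩ := Set.ssubset_iff_exists.1 hS
  obtain ⟨h, hh, hforceA⟩ := exists_forall_add_eq_imp_eq ⟨0, H.zero_mem⟩ hAB hAmin ha₀
  obtain ⟨q, -, hforceC⟩ := exists_forall_add_eq_imp_eq Set.univ_nonempty hCD hCmin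
    (Set.mem_image_of_mem _ hc₀)
  obtain ⟨_, ⟨c₁, hc₁, rfl⟩, _, ⟨d₀, hd₀, rfl⟩, hq⟩ := hCD.symm.subset (Set.mem_univ q)
  have hc₁₀ := hforceC _ ⟨c₁, hc₁, rfl⟩ _ ⟨d₀, hd₀, rfl⟩ hq
  simp only [hc₁₀] at hq
  obtain ⟨s, hs, _, ⟨b, hb, d, hd, rfl⟩, hsum⟩ :=
    hcover.symm.subset (Set.mem_univ (h + (c₀ + d₀)))
  obtain ⟨a, ha, c, hc, rfl⟩ := hsub hs
  have hmk : ∀ y ∈ H, (QuotientAddGroup.mk y : G ⧸ H) = 0 := fun y hy =>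
    (QuotientAddGroup.eq_zero_iff y).2 hy
  have hquot : (QuotientAddGroup.mk c : G ⧸ H) + QuotientAddGroup.mk d =
      QuotientAddGroup.mk c₀ + QuotientAddGroup.mk d₀ := by
    simpa [hmk a (hA ha), hmk b (hB hb), hmk h hh] using
      congrArg (QuotientAddGroup.mk (s := H)) hsum
  have hcc := hforceC _ ⟨c, hc, rfl⟩ _ ⟨d, hd, rfl⟩ (hquot.trans hq)
  obtain rfl := hCinj hc hc₀ hcc
  obtain rfl := hDinj hd hd₀ (add_left_cancel hquot)
  have hab : a + b = h := by
    have hsum' : a + c + (b + d) = h + (c + d) := hsum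
    rw [add_add_add_comm] at hsum'
    exact add_right_cancel hsum'
  obtain rfl := hforceA a ha b hb hab
  exact hx hs

/-- Let `H` be a subgroup of an abelian group `G`, let `(A, B)` be a co-minimal pair in
`H`, and let `C`, `D` be subsets of `G` whose images in `G ⧸ H` form a co-minimal pair,
the quotient map being injective on `C` and on `D`. Then `(A + C, B + D)` is a co-minimal
pair in `G`. -/
theorem coMinimalPair_add_of_subgroup {G : Type*} [AddCommGroup G] (H : AddSubgroup G)
    (A B C D : Set G)
    (hA : A ⊆ (H : Set G)) (hB : B ⊆ (H : Set G))
    (hAne : A.Nonempty) (hBne : B.Nonempty)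
    (hAB : A + B = (H : Set G))
    (hAmin : ∀ A' : Set G, A'.Nonempty → A' ⊂ A → A' + B ≠ (H : Set G))
    (hBmin : ∀ B' : Set G, B'.Nonempty → B' ⊂ B → A + B' ≠ (H : Set G))
    (hCD : IsCoMinimalPair ((QuotientAddGroup.mk '' C : Set (G ⧸ H)))
      ((QuotientAddGroup.mk '' D : Set (G ⧸ H))))
    (hCinj : Set.InjOn (QuotientAddGroup.mk (s := H)) C)
    (hDinj : Set.InjOn (QuotientAddGroup.mk (s := H)) D) :
    IsCoMinimalPair (A + C) (B + D) := by
  obtain ⟨hCne, hDne, hCDuniv, hCmin, hDmin⟩ := hCD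
  refine ⟨hAne.add hCne.of_image, hBne.add hDne.of_image, ?_, ?_, ?_⟩
  · refine Set.eq_univ_of_forall fun g => ?_
    obtain ⟨_, ⟨c, hc, rfl⟩, _, ⟨d, hd, rfl⟩, hcd⟩ :=
      hCDuniv.symm.subset (Set.mem_univ (QuotientAddGroup.mk g : G ⧸ H))
    have hmem : -(c + d) + g ∈ H := QuotientAddGroup.eq.1 hcd
    obtain ⟨a, ha, b, hb, hab⟩ := hAB.symm.subset hmem
    refine ⟨a + c, Set.add_mem_add ha hc, b + d, Set.add_mem_add hb hd, ?_⟩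
    change a + b = -(c + d) + g at hab
    change a + c + (b + d) = g
    rw [add_add_add_comm, hab]
    abel
  · exact fun S _ hS => add_ne_univ_of_ssubset_add hA hB hAB hAmin hCDuniv hCmin hCinj hDinj hS
  · intro S _ hS
    rw [add_comm]
    refine add_ne_univ_of_ssubset_add hB hA ((add_comm B A).trans hAB) (fun B' hne hss => ?_)
      ((add_comm _ _).trans hCDuniv) (fun D' hne hss => ?_) hDinj hCinj hS
    · rw [add_comm]
      exact hBmin B' hne hss
    · rw [add_comm]
      exact hDmin D' hne hss
end

section
/- Let (A, B) and (C, D) be co-minimal pairs in (ℤ, +), and let x: C → ℤ and y: D → ℤ be arbitrary functions. Then the sets {(a + x(c), c) : a ∈ A, c ∈ C} and {(b + y(d), d) : b ∈ B, d ∈ D} form a co-minimal pair in ℤ². -/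
open scoped Pointwise

theorem IsCoMinimalPair.symm {G : Type*} [AddCommGroup G] {A B : Set G}
    (h : IsCoMinimalPair A B) : IsCoMinimalPair B A := by
  obtain ⟨hA, hB, hAB, hminA, hminB⟩ := h
  refine ⟨hB, hA, by rwa [add_comm], fun B' h₁ h₂ => ?_, fun A' h₁ h₂ => ?_⟩
  · rw [add_comm]
    exact hminB B' h₁ h₂
  · rw [add_comm]
    exact hminA A' h₁ h₂

/-- Every element `a` of the left member of a co-minimal pair is indispensable: some `g` is
represented only with left summand `a`. -/
theorem IsCoMinimalPair.exists_forall_add_eq {G : Type*} [AddCommGroup G] {A B : Set G}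
    (h : IsCoMinimalPair A B) {a : G} (ha : a ∈ A) :
    ∃ g, ∀ a' ∈ A, ∀ b ∈ B, a' + b = g → a' = a := by
  obtain ⟨-, -, -, hmin, -⟩ := h
  by_contra! hcon
  obtain ⟨a₀, ha₀, -, -, -, hne⟩ := hcon 0
  refine hmin (A \ {a}) ⟨a₀, ha₀, hne⟩
    ⟨Set.sdiff_subset, fun hsub => (hsub ha).2 rfl⟩ (Set.eq_univ_of_forall fun g => ?_)
  obtain ⟨a', ha', b, hb, hg, hne'⟩ := hcon g
  exact ⟨a', ⟨ha', hne'⟩, b, hb, hg⟩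

/-- No proper subset of the first twisted product is a complement of the second one. -/
theorem twisted_product_add_ne_univ {A B C D : Set ℤ}
    (hAB : IsCoMinimalPair A B) (hCD : IsCoMinimalPair C D) (x y : ℤ → ℤ) {S : Set (ℤ × ℤ)}
    (hS : S ⊂ {p : ℤ × ℤ | ∃ a ∈ A, ∃ c ∈ C, p = (a + x c, c)}) :
    S + {p : ℤ × ℤ | ∃ b ∈ B, ∃ d ∈ D, p = (b + y d, d)} ≠ Set.univ := by
  intro hu
  obtain ⟨hsub, hnot⟩ := hS
  obtain ⟨_, ⟨a, ha, c, hc, rfl⟩, hp⟩ := Set.not_subset.mp hnot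
  obtain ⟨g, hg⟩ := hAB.exists_forall_add_eq ha
  obtain ⟨k, hk⟩ := hCD.exists_forall_add_eq hc
  have hmem : (g + x c + y (k - c), k) ∈
      S + {p : ℤ × ℤ | ∃ b ∈ B, ∃ d ∈ D, p = (b + y d, d)} := hu ▸ Set.mem_univ _
  obtain ⟨s, hs, _, ⟨b, hb, d, hd, rfl⟩, hsum⟩ := hmem
  obtain ⟨a', ha', c', hc', rfl⟩ := hsub hs
  simp only [Prod.mk_add_mk, Prod.mk.injEq] at hsum
  obtain ⟨h₁, h₂⟩ := hsum
  obtain rfl := hk c' hc' d hd h₂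
  obtain rfl : d = k - c' := by omega
  obtain rfl := hg a' ha' b hb (by omega)
  exact hp hs

/-- If `(A, B)` and `(C, D)` are co-minimal pairs in `ℤ` and `x`, `y` are arbitrary
integer-valued functions, then `{(a + x c, c) : a ∈ A, c ∈ C}` and
`{(b + y d, d) : b ∈ B, d ∈ D}` form a co-minimal pair in `ℤ²`. -/
theorem coMinimalPair_twisted_product (A B C D : Set ℤ)
    (hAB : IsCoMinimalPair A B) (hCD : IsCoMinimalPair C D) (x y : ℤ → ℤ) :
    IsCoMinimalPair
      {p : ℤ × ℤ | ∃ a ∈ A, ∃ c ∈ C, p = (a + x c, c)}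
      {p : ℤ × ℤ | ∃ b ∈ B, ∃ d ∈ D, p = (b + y d, d)} := by
  have ⟨⟨a, ha⟩, ⟨b, hb⟩, hABu, _⟩ := hAB
  have ⟨⟨c, hc⟩, ⟨d, hd⟩, hCDu, _⟩ := hCD
  refine ⟨⟨_, a, ha, c, hc, rfl⟩, ⟨_, b, hb, d, hd, rfl⟩,
    Set.eq_univ_of_forall fun ⟨m, n⟩ => ?_,
    fun S _ hS => twisted_product_add_ne_univ hAB hCD x y hS, fun S _ hS => ?_⟩
  · obtain ⟨c', hc', d', hd', hn⟩ : n ∈ C + D := hCDu ▸ Set.mem_univ n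
    obtain ⟨a', ha', b', hb', hm⟩ : m - x c' - y d' ∈ A + B := hABu ▸ Set.mem_univ _
    refine ⟨_, ⟨a', ha', c', hc', rfl⟩, _, ⟨b', hb', d', hd', rfl⟩, ?_⟩
    simp only at hm hn
    ext <;> simp only [Prod.mk_add_mk] <;> omega
  · rw [add_comm]
    exact twisted_product_add_ne_univ hAB.symm hCD.symm y x hS
end
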